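/- Let s ≥ 22 and let a_j, b_j ∈ ℤ (1 ≤ j ≤ s) satisfy the condition that for every pair (c,d) ∈ ℤ² \ {(0,0)} at least s − 7 of the numbers c·a_j + d·b_j (1 ≤ j ≤ s) are nonzero. Then the limit 𝔖 = lim_{X→∞} 𝔖(X) exists, and there is a constant C with |𝔖 − 𝔖(X)| ≤ C·X^{−1} for all X ≥ 1. Moreover, if for every prime p the system a_1x_1⁴ + ⋯ + a_sx_s⁴ = 0, b_1x_1⁴ + ⋯ + b_sx_s⁴ = 0 has a non-singular solution in ℚ_p^s (a solution x for which some 2×2 minor a_i x_i³ b_j x_j³ − a_j x_j³ b_i x_i³ is nonzero), then 𝔖 > 0. -/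

import Mathlib

open scoped Real
open Filter MeasureTheory

noncomputable section

/-- `e(z) = exp(2πiz)`. -/
def e (z : ℝ) : ℂ := Complex.exp (2 * Real.pi * Complex.I * z)

/-- The set `𝒜(P,R)` of `R`-smooth positive integers not exceeding `P`. -/
def smoothA (P R : ℝ) : Finset ℕ :=
  (Finset.Icc 1 ⌊P⌋₊).filter (fun n => ∀ p ∈ n.primeFactors, (p : ℝ) ≤ R)

/-- The smooth Weyl sum `h(α; P, R)`. -/
def h (P R α : ℝ) : ℂ := ∑ x ∈ smoothA P R, e (α * (x : ℝ) ^ 4)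

/-- `Δ₇ = 0.849408`. -/
def Δ₇ : ℝ := 0.849408

/-- `Δ₁₀ = 0.213431`. -/
def Δ₁₀ : ℝ := 0.213431

/-- The complete exponential sum `S(q,a) = Σ_{r=1}^q e(ar⁴/q)`. -/
def S (q : ℕ) (a : ℤ) : ℂ :=
  ∑ r ∈ Finset.Icc 1 q, e ((a : ℝ) * (r : ℝ) ^ 4 / (q : ℝ))

/-- `T(q,c,d) = q^{−s} ∏_{j=1}^s S(q, a_jc + b_jd)`. -/
def Tqcd (s : ℕ) (a b : Fin s → ℤ) (q : ℕ) (c d : ℤ) : ℂ :=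
  ((q : ℂ) ^ (s : ℕ))⁻¹ * ∏ j, S q (a j * c + b j * d)

/-- `𝔄(q) = Σ_{1 ≤ c,d ≤ q, gcd(q,c,d)=1} T(q,c,d)`. -/
def 𝔄 (s : ℕ) (a b : Fin s → ℤ) (q : ℕ) : ℂ :=
  ∑ c ∈ Finset.Icc 1 q, ∑ d ∈ (Finset.Icc 1 q).filter
      (fun d => Nat.gcd q (Nat.gcd c d) = 1),
    Tqcd s a b q (c : ℤ) (d : ℤ)

/-- The partial singular series `𝔖(X) = Σ_{1 ≤ q ≤ X} 𝔄(q)`. -/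
def 𝔖X (s : ℕ) (a b : Fin s → ℤ) (X : ℕ) : ℂ := ∑ q ∈ Finset.Icc 1 X, 𝔄 s a b q

lemma e_intCast_div (q : ℕ) [NeZero q] (m : ℤ) :
    e ((m : ℝ) / q) = ZMod.stdAddChar (m : ZMod q) := by
  rw [ZMod.stdAddChar_coe, e]
  congr 1
  push_cast
  ring

lemma sum_range_cast_zmod {M : Type*} [AddCommMonoid M] (q : ℕ) [NeZero q] (f : ZMod q → M) :
    ∑ n ∈ Finset.range q, f (n : ZMod q) = ∑ x, f x := by
  refine Finset.sum_nbij' (fun n => (n : ZMod q)) (fun x => x.val) ?_ ?_ ?_ ?_ ?_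
  · simp
  · intro x _
    simpa using ZMod.val_lt x
  · intro n hn
    exact ZMod.val_cast_of_lt (by simpa using hn)
  · intro x _
    simp
  · simp

lemma sum_Icc_cast_zmod {M : Type*} [AddCommMonoid M] (q : ℕ) [NeZero q] (f : ZMod q → M) :
    ∑ n ∈ Finset.Icc 1 q, f (n : ZMod q) = ∑ x, f x := by
  have h1 : ∑ n ∈ Finset.Icc 1 q, f (n : ZMod q)
      = ∑ n ∈ Finset.range q, f ((n : ZMod q) + 1) := by
    rw [Finset.range_eq_Ico, Finset.sum_Ico_add' (fun n : ℕ => f (n : ZMod q)) 0 q 1 |>.symm.trans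
      (Finset.sum_congr rfl fun n _ => by push_cast; rfl) |>.symm]
    rfl
  rw [h1, sum_range_cast_zmod q (fun x => f (x + 1))]
  exact Equiv.sum_comp (Equiv.addRight (1 : ZMod q)) f

lemma S_eq_sum_zmod (q : ℕ) [NeZero q] (m : ℤ) :
    S q m = ∑ x : ZMod q, ZMod.stdAddChar ((m : ZMod q) * x ^ 4) := by
  rw [← sum_Icc_cast_zmod q (fun x : ZMod q => ZMod.stdAddChar ((m : ZMod q) * x ^ 4)), S]
  refine Finset.sum_congr rfl fun r _ => ?_
  have := e_intCast_div q (m * (r : ℤ) ^ 4)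
  push_cast at this
  rw [this]

lemma S_eq_sum_range (q : ℕ) [NeZero q] (m : ℤ) :
    S q m = ∑ n ∈ Finset.range q, e (((m * (n : ℤ) ^ 4 : ℤ) : ℝ) / q) := by
  rw [S_eq_sum_zmod, ← sum_range_cast_zmod q]
  refine Finset.sum_congr rfl fun r _ => ?_
  rw [e_intCast_div]
  push_cast
  rfl

lemma S_one (m : ℤ) : S 1 m = 1 := by
  rw [S_eq_sum_range 1 m]
  simp [e]

lemma sum_range_mul_of_periodic {M : Type*} [AddCommMonoid M] (g r : ℕ) (f : ℕ → M)
    (hf : ∀ n, f (n + r) = f n) :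
    ∑ n ∈ Finset.range (g * r), f n = g • ∑ n ∈ Finset.range r, f n := by
  have hper : ∀ k n, f (k * r + n) = f n := by
    intro k n
    induction k with
    | zero => simp
    | succ k ih => rw [← ih, ← hf (k * r + n)]; congr 1; ring
  induction g with
  | zero => simp
  | succ g ih =>
    rw [Nat.succ_mul, Finset.sum_range_add, ih, succ_nsmul]
    congr 1
    exact Finset.sum_congr rfl fun n _ => hper g n

lemma e_quartic_periodic (q : ℕ) [NeZero q] (m : ℤ) (n : ℕ) :
    e (((m * ((n + q : ℕ) : ℤ) ^ 4 : ℤ) : ℝ) / q) = e (((m * (n : ℤ) ^ 4 : ℤ) : ℝ) / q) := by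
  rw [e_intCast_div, e_intCast_div]
  push_cast
  simp

lemma S_mul_mul (g r : ℕ) [NeZero g] [NeZero r] (m : ℤ) : S (g * r) (g * m) = g * S r m := by
  have hg : (g : ℝ) ≠ 0 := Nat.cast_ne_zero.mpr (NeZero.ne g)
  have hper := sum_range_mul_of_periodic g r
    (fun n => e (((m * (n : ℤ) ^ 4 : ℤ) : ℝ) / r)) (e_quartic_periodic r m)
  rw [nsmul_eq_mul] at hper
  rw [S_eq_sum_range, S_eq_sum_range, ← hper]
  refine Finset.sum_congr rfl fun n _ => ?_
  congr 1
  push_cast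
  rw [mul_assoc, mul_div_mul_left _ _ hg]

lemma norm_e (z : ℝ) : ‖e z‖ = 1 := by
  rw [e, show 2 * (Real.pi : ℂ) * Complex.I * z = ((2 * Real.pi * z : ℝ) : ℂ) * Complex.I by
    push_cast; ring]
  exact Complex.norm_exp_ofReal_mul_I _

lemma norm_S_le (q : ℕ) (m : ℤ) : ‖S q m‖ ≤ q := by
  refine (norm_sum_le _ _).trans ?_
  simp [norm_e]

lemma sum_stdAddChar_quartic_eq_ite (q p : ℕ) [NeZero q] (hp : p ≠ 0) (m t : ZMod q)
    (h2 : 6 * t ^ 2 = 0) (h3 : 4 * t ^ 3 = 0) (h4 : t ^ 4 = 0) (h5 : 4 * m * t * p = 0) :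
    ∑ x : ZMod q, ZMod.stdAddChar (m * x ^ 4)
      = ∑ x : ZMod q, if 4 * m * t * x ^ 3 = 0 then ZMod.stdAddChar (m * x ^ 4) else 0 := by
  have hp' : (p : ℂ) ≠ 0 := Nat.cast_ne_zero.mpr hp
  apply mul_left_cancel₀ hp'
  have hshift : ∀ y : ℕ, ∑ x : ZMod q, (ZMod.stdAddChar (m * (x + t * (y : ZMod q)) ^ 4) : ℂ)
      = ∑ x : ZMod q, (ZMod.stdAddChar (m * x ^ 4) : ℂ) := fun y =>
    Equiv.sum_comp (Equiv.addRight (t * (y : ZMod q)))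
      (fun x : ZMod q => (ZMod.stdAddChar (m * x ^ 4) : ℂ))
  have hexp : ∀ (y : ℕ) (x : ZMod q), (ZMod.stdAddChar (m * (x + t * (y : ZMod q)) ^ 4) : ℂ)
      = ZMod.stdAddChar (m * x ^ 4) * ZMod.stdAddChar (4 * m * t * x ^ 3) ^ y := by
    intro y x
    rw [← AddChar.map_nsmul_eq_pow, ← AddChar.map_add_eq_mul]
    congr 1
    rw [nsmul_eq_mul]
    linear_combination (m * x ^ 2 * (y : ZMod q) ^ 2) * h2 +
      (m * x * (y : ZMod q) ^ 3) * h3 + (m * (y : ZMod q) ^ 4) * h4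
  have hinner : ∀ x : ZMod q, ∑ y ∈ Finset.range p,
      (ZMod.stdAddChar (4 * m * t * x ^ 3) : ℂ) ^ y
      = if 4 * m * t * x ^ 3 = 0 then (p : ℂ) else 0 := by
    intro x
    split_ifs with h
    · simp [h]
    · have hne : (ZMod.stdAddChar (4 * m * t * x ^ 3) : ℂ) - 1 ≠ 0 := by
        rw [sub_ne_zero]
        intro h1
        apply h
        apply ZMod.injective_stdAddChar
        rw [h1, AddChar.map_zero_eq_one]
      apply mul_left_cancel₀ hne
      rw [mul_geom_sum, ← AddChar.map_nsmul_eq_pow, nsmul_eq_mul,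
        show (p : ZMod q) * (4 * m * t * x ^ 3) = 0 by 
          linear_combination x ^ 3 * h5]
      simp
  calc (p : ℂ) * ∑ x : ZMod q, ZMod.stdAddChar (m * x ^ 4)
      = ∑ y ∈ Finset.range p, ∑ x : ZMod q,
          (ZMod.stdAddChar (m * (x + t * (y : ZMod q)) ^ 4) : ℂ) := by
        simp [hshift]
    _ = ∑ x : ZMod q, ZMod.stdAddChar (m * x ^ 4) *
          ∑ y ∈ Finset.range p, (ZMod.stdAddChar (4 * m * t * x ^ 3) : ℂ) ^ y := by
        rw [Finset.sum_comm]
        simp_rw [hexp, Finset.mul_sum]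
    _ = _ := by
        rw [Finset.mul_sum]
        refine Finset.sum_congr rfl fun x _ => ?_
        rw [hinner]
        split_ifs <;> ring

lemma S_prime_pow_eq_sum_multiples {p k : ℕ} (hp : p.Prime) (hk : 1 ≤ k) (m t : ℤ)
    (h2 : (p ^ k : ℤ) ∣ 6 * t ^ 2) (h3 : (p ^ k : ℤ) ∣ 4 * t ^ 3) (h4 : (p ^ k : ℤ) ∣ t ^ 4)
    (h5 : ∀ x : ℤ, (p ^ k : ℤ) ∣ 4 * m * t * x ^ 3 ↔ (p : ℤ) ∣ x)
    (h6 : (p ^ k : ℤ) ∣ 4 * m * t * p) :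
    S (p ^ k) m = ∑ n ∈ Finset.range (p ^ (k - 1)),
      e (((m * ((p * n : ℕ) : ℤ) ^ 4 : ℤ) : ℝ) / (p ^ k : ℕ)) := by
  have : NeZero (p ^ k) := ⟨pow_ne_zero _ hp.ne_zero⟩
  have key : ∀ z : ℤ, (p ^ k : ℤ) ∣ z → (z : ZMod (p ^ k)) = 0 := by
    intro z hz
    rw [ZMod.intCast_zmod_eq_zero_iff_dvd]
    exact_mod_cast hz
  have hpk : p ^ k = p * p ^ (k - 1) := by
    rw [← pow_succ', Nat.sub_add_cancel hk]
  have h5' : (4 * m * t * p : ZMod (p ^ k)) = 0 := by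
    have := key _ h6
    push_cast at this
    exact this
  rw [S_eq_sum_zmod, sum_stdAddChar_quartic_eq_ite (p ^ k) p hp.ne_zero _ (t : ZMod (p ^ k))
    (by have := key _ h2; push_cast at this; exact this)
    (by have := key _ h3; push_cast at this; exact this)
    (by have := key _ h4; push_cast at this; exact this) h5',
    ← sum_range_cast_zmod (p ^ k)]
  have hiff : ∀ n : ℕ, (4 * (m : ZMod (p ^ k)) * t * (n : ZMod (p ^ k)) ^ 3 = 0) ↔ p ∣ n := by
    intro n
    have h8 := ZMod.intCast_zmod_eq_zero_iff_dvd (4 * m * t * (n : ℤ) ^ 3) (p ^ k)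
    push_cast at h8
    rw [h8, h5]
    exact Int.natCast_dvd_natCast
  simp_rw [hiff]
  rw [← Finset.sum_filter]
  symm
  refine Finset.sum_nbij (fun n => p * n) ?_ ?_ ?_ ?_
  · intro n hn
    simp only [Finset.mem_range, Finset.mem_filter] at hn ⊢
    refine ⟨?_, dvd_mul_right _ _⟩
    rw [hpk]
    exact Nat.mul_lt_mul_of_pos_left hn hp.pos
  · intro x _ y _ hxy
    exact Nat.eq_of_mul_eq_mul_left hp.pos hxy
  · intro n hn
    simp only [Finset.coe_filter, Finset.mem_range, Set.mem_ofPred_eq] at hn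
    obtain ⟨h7, c, rfl⟩ := hn
    refine ⟨c, ?_, rfl⟩
    rw [hpk] at h7
    simpa using lt_of_mul_lt_mul_left h7 (Nat.zero_le p)
  · intro n _
    rw [e_intCast_div]
    push_cast
    rfl

lemma S_prime_pow_eq_sum_multiples_of_not_dvd {p k : ℕ} (hp : p.Prime) {m : ℤ}
    (hm : ¬ (p : ℤ) ∣ m) (hk : p ≠ 2 ∧ 2 ≤ k ∨ p = 2 ∧ 5 ≤ k) :
    S (p ^ k) m = ∑ n ∈ Finset.range (p ^ (k - 1)),
      e (((m * ((p * n : ℕ) : ℤ) ^ 4 : ℤ) : ℝ) / (p ^ k : ℕ)) := by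
  have hpz : Prime (p : ℤ) := Nat.prime_iff_prime_int.mp hp
  have hp0 : (p : ℤ) ≠ 0 := hpz.ne_zero
  rcases hk with ⟨h2, hk⟩ | ⟨rfl, hk⟩
  · obtain ⟨l, rfl⟩ : ∃ l, k = l + 2 := ⟨k - 2, by omega⟩
    have h4 : ¬ (p : ℤ) ∣ 4 := by
      intro h
      have h' : p ∣ 2 ^ 2 := by exact_mod_cast h
      exact h2 ((Nat.prime_dvd_prime_iff_eq hp Nat.prime_two).mp (hp.dvd_of_dvd_pow h'))
    refine S_prime_pow_eq_sum_multiples hp (by omega) m ((p : ℤ) ^ (l + 1)) ?_ ?_ ?_ ?_ ?_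
    · exact ⟨6 * (p : ℤ) ^ l, by ring⟩
    · exact ⟨4 * (p : ℤ) ^ (2 * l + 1), by ring⟩
    · exact ⟨(p : ℤ) ^ (3 * l + 2), by ring⟩
    · intro x
      rw [show 4 * m * (p : ℤ) ^ (l + 1) * x ^ 3 = (p : ℤ) ^ (l + 1) * (4 * m * x ^ 3) by ring,
        pow_succ _ (l + 1), mul_dvd_mul_iff_left (pow_ne_zero _ hp0)]
      constructor
      · intro h
        rcases hpz.dvd_or_dvd h with h | h
        · rcases hpz.dvd_or_dvd h with h | h
          · exact absurd h h4
          · exact absurd h hm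
        · exact hpz.dvd_of_dvd_pow h
      · intro h
        exact Dvd.dvd.mul_left (dvd_pow h (by norm_num)) _
    · exact ⟨4 * m, by ring⟩
  · obtain ⟨l, rfl⟩ : ∃ l, k = l + 5 := ⟨k - 5, by omega⟩
    refine S_prime_pow_eq_sum_multiples hp (by omega) m ((2 : ℤ) ^ (l + 2)) ?_ ?_ ?_ ?_ ?_
    · exact ⟨3 * (2 : ℤ) ^ l, by push_cast; ring⟩
    · exact ⟨(2 : ℤ) ^ (2 * l + 3), by push_cast; ring⟩
    · exact ⟨(2 : ℤ) ^ (3 * l + 3), by push_cast; ring⟩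
    · intro x
      push_cast
      rw [show 4 * m * (2 : ℤ) ^ (l + 2) * x ^ 3 = (2 : ℤ) ^ (l + 4) * (m * x ^ 3) by ring,
        pow_succ _ (l + 4), mul_dvd_mul_iff_left (pow_ne_zero _ (by norm_num))]
      push_cast at hm hpz
      constructor
      · intro h
        rcases hpz.dvd_or_dvd h with h | h
        · exact absurd h hm
        · exact hpz.dvd_of_dvd_pow h
      · intro h
        exact Dvd.dvd.mul_left (dvd_pow h (by norm_num)) _
    · exact ⟨m, by push_cast; ring⟩

lemma norm_S_prime_pow_le {p k : ℕ} (hp : p.Prime) {m : ℤ}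
    (hm : ¬ (p : ℤ) ∣ m) (hk : p ≠ 2 ∧ 2 ≤ k ∨ p = 2 ∧ 5 ≤ k) :
    ‖S (p ^ k) m‖ ≤ (p : ℝ) ^ (k - 1) := by
  rw [S_prime_pow_eq_sum_multiples_of_not_dvd hp hm hk]
  refine (norm_sum_le _ _).trans ?_
  simp [norm_e]

lemma S_prime_pow_add_four {p k : ℕ} (hp : p.Prime) {m : ℤ}
    (hm : ¬ (p : ℤ) ∣ m) (hk : p ≠ 2 ∨ 1 ≤ k) :
    S (p ^ (k + 4)) m = (p : ℂ) ^ 3 * S (p ^ k) m := by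
  have : NeZero (p ^ k) := ⟨pow_ne_zero _ hp.ne_zero⟩
  have hp0 : (p : ℝ) ≠ 0 := Nat.cast_ne_zero.mpr hp.ne_zero
  have hper := sum_range_mul_of_periodic (p ^ 3) (p ^ k)
    (fun n => e (((m * (n : ℤ) ^ 4 : ℤ) : ℝ) / (p ^ k : ℕ))) (e_quartic_periodic (p ^ k) m)
  rw [S_prime_pow_eq_sum_multiples_of_not_dvd hp hm (by omega), S_eq_sum_range (p ^ k),
    show k + 4 - 1 = 3 + k by omega, pow_add p 3 k]
  rw [nsmul_eq_mul] at hper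
  push_cast at hper ⊢
  rw [← hper]
  refine Finset.sum_congr rfl fun n _ => ?_
  congr 1
  field_simp
  ring

lemma card_filter_pow_four_le (p : ℕ) [Fact p.Prime] (c : ZMod p) :
    (Finset.univ.filter (fun x : ZMod p => x ^ 4 = c)).card ≤ 4 := by
  classical
  have h : (Finset.univ.filter (fun x : ZMod p => x ^ 4 = c)) ⊆
      (Polynomial.nthRoots 4 c).toFinset := by
    intro x hx
    simp only [Finset.mem_filter, Finset.mem_univ, true_and] at hx
    rw [Multiset.mem_toFinset, Polynomial.mem_nthRoots (by norm_num)]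
    exact hx
  exact (Finset.card_le_card h).trans
    ((Multiset.toFinset_card_le _).trans (Polynomial.card_nthRoots 4 c))

lemma sum_normSq_S_prime_le (p : ℕ) [Fact p.Prime] :
    ∑ u : ZMod p, ‖∑ x : ZMod p, (ZMod.stdAddChar (u * x ^ 4) : ℂ)‖ ^ 2 ≤ 4 * (p : ℝ) ^ 2 := by
  have h1 : ((∑ u : ZMod p, ‖∑ x : ZMod p, (ZMod.stdAddChar (u * x ^ 4) : ℂ)‖ ^ 2 : ℝ) : ℂ)
      = ((p * ∑ y : ZMod p,
        (Finset.univ.filter (fun x : ZMod p => x ^ 4 = y ^ 4)).card : ℕ) : ℂ) := by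
    push_cast
    calc ∑ u : ZMod p, ((‖∑ x : ZMod p, (ZMod.stdAddChar (u * x ^ 4) : ℂ)‖ : ℂ)) ^ 2
        = ∑ u : ZMod p, ∑ y : ZMod p, ∑ x : ZMod p,
            (ZMod.stdAddChar (u * (x ^ 4 - y ^ 4)) : ℂ) := by
          refine Finset.sum_congr rfl fun u _ => ?_
          rw [← Complex.mul_conj', map_sum, Finset.sum_mul_sum, Finset.sum_comm]
          refine Finset.sum_congr rfl fun y _ => Finset.sum_congr rfl fun x _ => ?_
          rw [← AddChar.map_neg_eq_conj, ← AddChar.map_add_eq_mul]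
          congr 1
          ring
      _ = ∑ y : ZMod p, ∑ x : ZMod p, (if x ^ 4 = y ^ 4 then (p : ℂ) else 0) := by
          rw [Finset.sum_comm]
          refine Finset.sum_congr rfl fun y _ => ?_
          rw [Finset.sum_comm]
          refine Finset.sum_congr rfl fun x _ => ?_
          rw [AddChar.sum_mulShift _ (ZMod.isPrimitive_stdAddChar p), ZMod.card]
          simp only [sub_eq_zero]
          split_ifs <;> simp
      _ = _ := by
          rw [Finset.mul_sum]
          refine Finset.sum_congr rfl fun y _ => ?_
          rw [← Finset.sum_filter, Finset.sum_const, nsmul_eq_mul, mul_comm]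
  have h2 : (∑ u : ZMod p, ‖∑ x : ZMod p, (ZMod.stdAddChar (u * x ^ 4) : ℂ)‖ ^ 2 : ℝ)
      = ((p * ∑ y : ZMod p,
        (Finset.univ.filter (fun x : ZMod p => x ^ 4 = y ^ 4)).card : ℕ) : ℝ) := by
    exact_mod_cast h1
  rw [h2]
  have h3 : ∑ y : ZMod p, (Finset.univ.filter (fun x : ZMod p => x ^ 4 = y ^ 4)).card ≤ p * 4 := by
    refine (Finset.sum_le_sum fun y _ => card_filter_pow_four_le p (y ^ 4)).trans ?_
    simp
  calc ((p * ∑ y : ZMod p,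
        (Finset.univ.filter (fun x : ZMod p => x ^ 4 = y ^ 4)).card : ℕ) : ℝ)
      ≤ ((p * (p * 4) : ℕ) : ℝ) := by exact_mod_cast Nat.mul_le_mul_left p h3
    _ = 4 * (p : ℝ) ^ 2 := by push_cast; ring

lemma norm_S_prime_sq_le {p : ℕ} (hp : p.Prime) {m : ℤ} (hm : ¬ (p : ℤ) ∣ m) :
    ‖S p m‖ ^ 2 ≤ 32 * p := by
  have : Fact p.Prime := ⟨hp⟩
  have hm0 : (m : ZMod p) ≠ 0 := by rwa [Ne, ZMod.intCast_zmod_eq_zero_iff_dvd]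
  set G : ZMod p → ℂ := fun u => ∑ x : ZMod p, (ZMod.stdAddChar (u * x ^ 4) : ℂ) with hG
  have hS : S p m = G m := S_eq_sum_zmod p m
  have hinv : ∀ t : ZMod p, t ≠ 0 → G (m * t ^ 4) = G m := by
    intro t ht
    rw [hG]
    refine Fintype.sum_equiv (Equiv.mulLeft₀ t ht) _ _ fun x => ?_
    congr 1
    rw [Equiv.mulLeft₀_apply]
    ring
  have hcount : ∑ t ∈ Finset.univ.erase (0 : ZMod p), ‖G (m * t ^ 4)‖ ^ 2
      ≤ 4 * ∑ u : ZMod p, ‖G u‖ ^ 2 := by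
    calc ∑ t ∈ Finset.univ.erase (0 : ZMod p), ‖G (m * t ^ 4)‖ ^ 2
        ≤ ∑ t : ZMod p, ‖G (m * t ^ 4)‖ ^ 2 :=
          Finset.sum_le_sum_of_subset_of_nonneg (Finset.erase_subset _ _) fun _ _ _ => by positivity
      _ = ∑ u : ZMod p, ∑ t ∈ Finset.univ.filter (fun t : ZMod p => m * t ^ 4 = u),
            ‖G (m * t ^ 4)‖ ^ 2 := (Finset.sum_fiberwise _ _ _).symm
      _ ≤ ∑ u : ZMod p, 4 * ‖G u‖ ^ 2 := by
          refine Finset.sum_le_sum fun u _ => ?_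
          rw [Finset.sum_congr rfl (g := fun _ => ‖G u‖ ^ 2) fun t ht => by
            rw [(Finset.mem_filter.mp ht).2], Finset.sum_const, nsmul_eq_mul]
          have hcard : (Finset.univ.filter (fun t : ZMod p => m * t ^ 4 = u)).card ≤ 4 := by
            refine le_trans (le_of_eq ?_) (card_filter_pow_four_le p ((m : ZMod p)⁻¹ * u))
            congr 1
            ext t
            simp only [Finset.mem_filter, Finset.mem_univ, true_and]
            rw [eq_inv_mul_iff_mul_eq₀ hm0]
          exact mul_le_mul_of_nonneg_right (by exact_mod_cast hcard) (by positivity)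
      _ = _ := by rw [Finset.mul_sum]
  rw [Finset.sum_congr rfl (g := fun _ => ‖G m‖ ^ 2) fun t ht => by
    rw [hinv t (Finset.ne_of_mem_erase ht)], Finset.sum_const, nsmul_eq_mul,
    Finset.card_erase_of_mem (Finset.mem_univ _), Finset.card_univ, ZMod.card,
    Nat.cast_sub hp.one_le] at hcount
  have h1 := sum_normSq_S_prime_le p
  have hp2 : (2 : ℝ) ≤ p := by exact_mod_cast hp.two_le
  rw [hS]
  have h2 : ((p : ℝ) - 1) * ‖G m‖ ^ 2 ≤ 16 * (p : ℝ) ^ 2 := by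
    push_cast at hcount
    linarith
  have h3 : (p : ℝ) / 2 * ‖G m‖ ^ 2 ≤ (p : ℝ) / 2 * (32 * p) := by
    have : (p : ℝ) / 2 * ‖G m‖ ^ 2 ≤ ((p : ℝ) - 1) * ‖G m‖ ^ 2 :=
      mul_le_mul_of_nonneg_right (by linarith) (by positivity)
    linarith
  exact le_of_mul_le_mul_left h3 (by linarith)

lemma norm_S_prime_pow_pow_four_le_of_not_dvd {p : ℕ} (hp : p.Prime) (k : ℕ) {m : ℤ}
    (hm : ¬ (p : ℤ) ∣ m) : ‖S (p ^ k) m‖ ^ 4 ≤ 1024 * (p : ℝ) ^ (3 * k) := by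
  have hp1 : (1 : ℝ) ≤ p := by exact_mod_cast hp.one_le
  induction k using Nat.strong_induction_on with
  | _ k ih =>
    by_cases hk : k ≤ 4
    · rcases Nat.lt_or_ge k 2 with h2 | h2
      · interval_cases k
        · rw [pow_zero, S_one]; norm_num
        · have h3 := norm_S_prime_sq_le hp hm
          rw [pow_one]
          calc ‖S p m‖ ^ 4 = (‖S p m‖ ^ 2) ^ 2 := by ring
            _ ≤ (32 * (p : ℝ)) ^ 2 := pow_le_pow_left₀ (by positivity) h3 2
            _ = 1024 * (p : ℝ) ^ 2 := by ring
            _ ≤ 1024 * (p : ℝ) ^ (3 * 1) :=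
              mul_le_mul_of_nonneg_left (pow_le_pow_right₀ hp1 (by norm_num)) (by norm_num)
      · by_cases hp2 : p = 2
        · subst hp2
          calc ‖S (2 ^ k) m‖ ^ 4 ≤ (((2 ^ k : ℕ) : ℝ)) ^ 4 :=
                pow_le_pow_left₀ (by positivity) (norm_S_le _ _) 4
            _ = 2 ^ k * ((2 : ℕ) : ℝ) ^ (3 * k) := by push_cast; ring
            _ ≤ 1024 * ((2 : ℕ) : ℝ) ^ (3 * k) := by
              refine mul_le_mul_of_nonneg_right ?_ (by positivity)
              calc (2 : ℝ) ^ k ≤ 2 ^ 4 := pow_le_pow_right₀ (by norm_num) hk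
                _ ≤ 1024 := by norm_num
        · calc ‖S (p ^ k) m‖ ^ 4 ≤ ((p : ℝ) ^ (k - 1)) ^ 4 :=
                pow_le_pow_left₀ (by positivity) (norm_S_prime_pow_le hp hm (Or.inl ⟨hp2, h2⟩)) 4
            _ = (p : ℝ) ^ ((k - 1) * 4) := by rw [← pow_mul]
            _ ≤ (p : ℝ) ^ (3 * k) := pow_le_pow_right₀ hp1 (by omega)
            _ ≤ 1024 * (p : ℝ) ^ (3 * k) := le_mul_of_one_le_left (by positivity) (by norm_num)
    · obtain ⟨l, rfl⟩ : ∃ l, k = l + 4 := ⟨k - 4, by omega⟩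
      rw [S_prime_pow_add_four hp hm (Or.inr (by omega)), norm_mul, mul_pow, norm_pow,
        Complex.norm_natCast]
      calc ((p : ℝ) ^ 3) ^ 4 * ‖S (p ^ l) m‖ ^ 4
          ≤ ((p : ℝ) ^ 3) ^ 4 * (1024 * (p : ℝ) ^ (3 * l)) :=
            mul_le_mul_of_nonneg_left (ih l (by omega)) (by positivity)
        _ = 1024 * (p : ℝ) ^ (3 * (l + 4)) := by ring

lemma norm_S_prime_pow_pow_four_le {p : ℕ} (hp : p.Prime) (k v : ℕ) {m : ℤ}
    (hm : ¬ (p : ℤ) ^ (v + 1) ∣ m) : ‖S (p ^ k) m‖ ^ 4 ≤ 1024 * (p : ℝ) ^ (3 * k + v) := by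
  have hp1 : (1 : ℝ) ≤ p := by exact_mod_cast hp.one_le
  have : NeZero p := ⟨hp.ne_zero⟩
  induction v generalizing k m with
  | zero => simpa using norm_S_prime_pow_pow_four_le_of_not_dvd hp k (by simpa using hm)
  | succ v ih =>
    by_cases hpm : (p : ℤ) ∣ m
    · obtain ⟨m', rfl⟩ := hpm
      have hm' : ¬ (p : ℤ) ^ (v + 1) ∣ m' := by
        intro h
        apply hm
        rw [pow_succ' _ (v + 1)]
        exact mul_dvd_mul_left _ h
      rcases k with _ | k
      · rw [pow_zero, S_one]
        simpa using one_le_mul_of_one_le_of_one_le (by norm_num : (1 : ℝ) ≤ 1024)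
          (one_le_pow₀ hp1 (n := v + 1))
      · rw [pow_succ' p k, S_mul_mul, norm_mul, mul_pow, Complex.norm_natCast]
        calc (p : ℝ) ^ 4 * ‖S (p ^ k) m'‖ ^ 4
            ≤ (p : ℝ) ^ 4 * (1024 * (p : ℝ) ^ (3 * k + v)) :=
              mul_le_mul_of_nonneg_left (ih k hm') (by positivity)
          _ = _ := by ring
    · refine (norm_S_prime_pow_pow_four_le_of_not_dvd hp k hpm).trans ?_
      exact mul_le_mul_of_nonneg_left (pow_le_pow_right₀ hp1 (by omega)) (by norm_num)

lemma exists_discriminant (s : ℕ) (a b : Fin s → ℤ)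
    (hcond : ∀ c d : ℤ, ¬(c = 0 ∧ d = 0) →
      s - 7 ≤ (Finset.univ.filter (fun j : Fin s => c * a j + d * b j ≠ 0)).card) :
    ∃ D : ℕ, 0 < D ∧ ∀ p : ℕ, p.Prime → ∀ v : ℕ, ¬ p ^ (v + 1) ∣ D → ∀ c d : ℤ,
      ¬ ((p : ℤ) ∣ c ∧ (p : ℤ) ∣ d) →
      s - 7 ≤ (Finset.univ.filter
        (fun j : Fin s => ¬ (p : ℤ) ^ (v + 1) ∣ a j * c + b j * d)).card := by
  classical
  set F : Fin s × Fin s → ℕ := fun i =>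
    if a i.1 * b i.2 - a i.2 * b i.1 = 0 then 1 else (a i.1 * b i.2 - a i.2 * b i.1).natAbs with hF
  refine ⟨∏ i, F i, ?_, ?_⟩
  · refine Finset.prod_pos fun i _ => ?_
    simp only [hF]
    split_ifs with h
    · exact one_pos
    · exact Int.natAbs_pos.mpr h
  intro p hp v hv c d hcd
  have hpz : Prime (p : ℤ) := Nat.prime_iff_prime_int.mp hp
  have hprop : ∀ i j : Fin s, (p : ℤ) ^ (v + 1) ∣ a i * c + b i * d →
      (p : ℤ) ^ (v + 1) ∣ a j * c + b j * d → a i * b j - a j * b i = 0 := by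
    intro i j hi hj
    by_contra hne
    apply hv
    have h1 : (p : ℤ) ^ (v + 1) ∣ (a i * b j - a j * b i) * c := by
      have : (a i * b j - a j * b i) * c
        = b j * (a i * c + b i * d) - b i * (a j * c + b j * d) := by ring
      rw [this]
      exact dvd_sub (Dvd.dvd.mul_left hi _) (Dvd.dvd.mul_left hj _)
    have h2 : (p : ℤ) ^ (v + 1) ∣ (a i * b j - a j * b i) * d := by
      have : (a i * b j - a j * b i) * d
        = a i * (a j * c + b j * d) - a j * (a i * c + b i * d) := by ring
      rw [this]
      exact dvd_sub (Dvd.dvd.mul_left hj _) (Dvd.dvd.mul_left hi _)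
    have h3 : (p : ℤ) ^ (v + 1) ∣ a i * b j - a j * b i := by
      rcases not_and_or.mp hcd with h | h
      · exact hpz.pow_dvd_of_dvd_mul_right _ h h1
      · exact hpz.pow_dvd_of_dvd_mul_right _ h h2
    have h4 : p ^ (v + 1) ∣ F (i, j) := by
      simp only [hF, if_neg hne]
      rw [← Int.natCast_dvd]
      exact_mod_cast h3
    exact h4.trans (Finset.dvd_prod_of_mem F (Finset.mem_univ (i, j)))
  obtain ⟨c', d', hne, hB⟩ : ∃ c' d' : ℤ, ¬(c' = 0 ∧ d' = 0) ∧
      ∀ j, (p : ℤ) ^ (v + 1) ∣ a j * c + b j * d → c' * a j + d' * b j = 0 := by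
    by_cases hex : ∃ i, (p : ℤ) ^ (v + 1) ∣ a i * c + b i * d ∧ ¬ (a i = 0 ∧ b i = 0)
    · obtain ⟨i, hi, hi0⟩ := hex
      refine ⟨-b i, a i, fun h => hi0 ⟨h.2, neg_eq_zero.mp h.1⟩, fun j hj => ?_⟩
      linear_combination hprop i j hi hj
    · push Not at hex
      refine ⟨1, 0, by simp, fun j hj => ?_⟩
      simp [(hex j hj).1]
  refine (hcond c' d' hne).trans (Finset.card_le_card fun j hj => ?_)
  simp only [Finset.mem_filter, Finset.mem_univ, true_and] at hj ⊢
  exact fun h => hj (hB j h)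

lemma norm_Tqcd_pow_le {s : ℕ} (hs : 22 ≤ s) (a b : Fin s → ℤ) (q n : ℕ) (hq : 0 < q)
    (c d : ℤ) (B : ℝ) (G : Finset (Fin s)) (hG : s - 7 ≤ G.card)
    (hB : ∀ j ∈ G, (‖S q (a j * c + b j * d)‖ / q) ^ n ≤ B) :
    ‖Tqcd s a b q c d‖ ^ n ≤ B ^ 15 := by
  have hq' : (0 : ℝ) < q := by exact_mod_cast hq
  obtain ⟨H, hHG, hH⟩ := Finset.exists_subset_card_eq (show 15 ≤ G.card by omega)
  have h1 : ‖Tqcd s a b q c d‖ ^ n = ∏ j, (‖S q (a j * c + b j * d)‖ / q) ^ n := by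
    rw [Finset.prod_pow, Finset.prod_div_distrib, Tqcd, norm_mul, norm_inv, norm_pow, norm_prod,
      Complex.norm_natCast, Finset.prod_const, Finset.card_univ, Fintype.card_fin, inv_mul_eq_div]
  have h2 : ∀ j ∈ Finset.univ, (‖S q (a j * c + b j * d)‖ / q) ^ n ≤ if j ∈ H then B else 1 := by
    intro j _
    split_ifs with h
    · exact hB j (hHG h)
    · exact pow_le_one₀ (by positivity) ((div_le_one hq').mpr (norm_S_le _ _))
  rw [h1]
  refine (Finset.prod_le_prod (fun j _ => by positivity) h2).trans ?_
  rw [Finset.prod_ite_mem, Finset.univ_inter, Finset.prod_const, hH]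

lemma norm_𝔄_pow_le (s : ℕ) (a b : Fin s → ℤ) (q n : ℕ) (M : ℝ)
    (hM : ∀ c d : ℕ, Nat.gcd q (Nat.gcd c d) = 1 → ‖Tqcd s a b q c d‖ ^ n ≤ M) (hn : n ≠ 0)
    (hM0 : 0 ≤ M) :
    ‖𝔄 s a b q‖ ^ n ≤ ((q : ℝ) ^ 2) ^ n * M := by
  set R : ℝ := M ^ ((n : ℝ)⁻¹) with hR
  have hR0 : 0 ≤ R := Real.rpow_nonneg hM0 _
  have hRn : R ^ n = M := Real.rpow_inv_natCast_pow hM0 hn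
  have h1 : ∀ c d : ℕ, Nat.gcd q (Nat.gcd c d) = 1 → ‖Tqcd s a b q c d‖ ≤ R := by
    intro c d h
    have := hM c d h
    rw [← hRn] at this
    exact le_of_pow_le_pow_left₀ hn hR0 this
  have h2 : ‖𝔄 s a b q‖ ≤ (q : ℝ) ^ 2 * R := by
    rw [𝔄]
    calc _ ≤ ∑ c ∈ Finset.Icc 1 q, (q : ℝ) * R := by
          refine norm_sum_le_of_le _ fun c _ => ?_
          refine (norm_sum_le_of_le _ (f := fun d : ℕ => Tqcd s a b q c d) (n := fun _ => R)
            fun d hd => h1 c d (Finset.mem_filter.mp hd).2).trans ?_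
          rw [Finset.sum_const, nsmul_eq_mul]
          refine mul_le_mul_of_nonneg_right ?_ hR0
          have := Finset.card_filter_le (Finset.Icc 1 q)
            (fun d : ℕ => Nat.gcd q (Nat.gcd c d) = 1)
          rw [Nat.card_Icc, Nat.add_sub_cancel] at this
          exact_mod_cast this
      _ = (q : ℝ) ^ 2 * R := by
          rw [Finset.sum_const, Nat.card_Icc, Nat.add_sub_cancel, nsmul_eq_mul]; ring
  calc ‖𝔄 s a b q‖ ^ n ≤ ((q : ℝ) ^ 2 * R) ^ n := pow_le_pow_left₀ (norm_nonneg _) h2 n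
    _ = _ := by rw [mul_pow, hRn]

lemma local_bound (s : ℕ) (hs : 22 ≤ s) (a b : Fin s → ℤ)
    (hcond : ∀ c d : ℤ, ¬(c = 0 ∧ d = 0) →
      s - 7 ≤ (Finset.univ.filter (fun j : Fin s => c * a j + d * b j ≠ 0)).card) :
    ∃ K : ℝ, 0 ≤ K ∧ ∀ p : ℕ, p.Prime → ∀ j : ℕ,
      ((p ^ (j + 1) : ℕ) : ℝ) * ‖𝔄 s a b (p ^ (j + 1))‖
        ≤ K * (p : ℝ) ^ (-(3 / 2) : ℝ) * (3 / 5) ^ j := by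
  obtain ⟨D, hD, hgood⟩ := exists_discriminant s a b hcond
  have hD1 : (1 : ℝ) ≤ D := by exact_mod_cast hD
  set C : ℝ := (1024 * D) ^ 15 with hC
  have hC1 : 1 ≤ C := one_le_pow₀ (by linarith)
  refine ⟨5 / 3 * C, by positivity, fun p hp j => ?_⟩
  have hp2 : (2 : ℝ) ≤ p := by exact_mod_cast hp.two_le
  have hp0 : (0 : ℝ) < p := by linarith
  set σ : ℝ := (p : ℝ) ^ (-(3 / 2) : ℝ) with hσ
  have hσ0 : 0 < σ := Real.rpow_pos_of_pos hp0 _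
  have hσ2 : σ ^ 2 * (p : ℝ) ^ 3 = 1 := by
    rw [hσ, ← Real.rpow_natCast, ← Real.rpow_mul hp0.le, ← Real.rpow_natCast (p : ℝ) 3,
      ← Real.rpow_add hp0]
    norm_num
  have hprim : ∀ c d : ℕ, Nat.gcd (p ^ (j + 1)) (Nat.gcd c d) = 1 →
      ¬ ((p : ℤ) ∣ (c : ℤ) ∧ (p : ℤ) ∣ (d : ℤ)) := by
    rintro c d hg ⟨h1, h2⟩
    have h3 : p ∣ Nat.gcd (p ^ (j + 1)) (Nat.gcd c d) :=
      Nat.dvd_gcd (dvd_pow_self _ (by omega))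
        (Nat.dvd_gcd (Int.natCast_dvd_natCast.mp h1) (Int.natCast_dvd_natCast.mp h2))
    rw [hg] at h3
    exact hp.one_lt.ne' (Nat.dvd_one.mp h3)
  rcases j with _ | j
  · rw [zero_add, pow_one, pow_zero, mul_one]
    have hb : ‖𝔄 s a b p‖ ^ 2 ≤ ((p : ℝ) ^ 2) ^ 2 * (32 * D / p) ^ 15 := by
      refine norm_𝔄_pow_le s a b p 2 _ (fun c d hg => ?_) (by norm_num) (by positivity)
      rw [zero_add, pow_one] at hprim
      by_cases hpD : p ∣ D
      · refine norm_Tqcd_pow_le hs a b p 2 hp.pos c d (32 * D / p) Finset.univ (by simp) ?_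
        intro i _
        have hpD' : (p : ℝ) ≤ D := by exact_mod_cast Nat.le_of_dvd hD hpD
        refine (pow_le_one₀ (by positivity) ((div_le_one hp0).mpr (norm_S_le _ _))).trans ?_
        rw [le_div_iff₀ hp0]
        linarith
      · refine norm_Tqcd_pow_le hs a b p 2 hp.pos c d (32 * D / p) _
          (hgood p hp 0 (by simpa using hpD) c d (hprim c d hg)) ?_
        intro i hi
        have hi' : ¬ (p : ℤ) ∣ a i * c + b i * d := by
          simpa using (Finset.mem_filter.mp hi).2
        have hS := norm_S_prime_sq_le hp hi'
        rw [div_pow, div_le_div_iff₀ (by positivity) hp0]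
        calc ‖S p (a i * c + b i * d)‖ ^ 2 * p ≤ 32 * p * p := by gcongr
          _ ≤ 32 * D * p ^ 2 := by
            rw [pow_two, ← mul_assoc]
            gcongr
            linarith
    refine le_of_pow_le_pow_left₀ two_ne_zero (by positivity) ?_
    have hpp : (1 : ℝ) ≤ p := by linarith
    have h1 : ((p : ℝ) * ‖𝔄 s a b p‖) ^ 2 * (p : ℝ) ^ 3 ≤ C := by
      calc ((p : ℝ) * ‖𝔄 s a b p‖) ^ 2 * (p : ℝ) ^ 3
          = (p : ℝ) ^ 5 * ‖𝔄 s a b p‖ ^ 2 := by ring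
        _ ≤ (p : ℝ) ^ 5 * (((p : ℝ) ^ 2) ^ 2 * (32 * D / p) ^ 15) := by gcongr
        _ = (32 * D) ^ 15 * ((p : ℝ) ^ 9 / (p : ℝ) ^ 15) := by rw [div_pow]; ring
        _ ≤ (32 * D) ^ 15 * 1 := by
          refine mul_le_mul_of_nonneg_left ?_ (by positivity)
          rw [div_le_one (by positivity)]
          exact pow_le_pow_right₀ hpp (by norm_num)
        _ ≤ C := by
          rw [mul_one, hC]
          gcongr
          norm_num
    calc ((p : ℝ) * ‖𝔄 s a b p‖) ^ 2
        = ((p : ℝ) * ‖𝔄 s a b p‖) ^ 2 * (σ ^ 2 * (p : ℝ) ^ 3) := by rw [hσ2, mul_one]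
      _ = (((p : ℝ) * ‖𝔄 s a b p‖) ^ 2 * (p : ℝ) ^ 3) * σ ^ 2 := by ring
      _ ≤ C * σ ^ 2 := by gcongr
      _ ≤ (5 / 3 * C) ^ 2 * σ ^ 2 := by
        gcongr
        nlinarith
      _ = (5 / 3 * C * σ) ^ 2 := by ring
  · set k := j + 1 + 1 with hk
    have hq0 : 0 < p ^ k := pow_pos hp.pos _
    set Q : ℝ := (p : ℝ) ^ k with hQ
    have hQ0 : 0 < Q := by positivity
    have hQc : ((p ^ k : ℕ) : ℝ) = Q := by push_cast; rfl
    have hb : ‖𝔄 s a b (p ^ k)‖ ^ 4 ≤ (Q ^ 2) ^ 4 * (1024 * D / Q) ^ 15 := by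
      rw [← hQc]
      refine norm_𝔄_pow_le s a b (p ^ k) 4 _ (fun c d hg => ?_) (by norm_num) (by positivity)
      have hfin : FiniteMultiplicity p D :=
        Nat.finiteMultiplicity_iff.mpr ⟨hp.one_lt.ne', hD⟩
      set v := multiplicity p D with hv
      have hv1 : ¬ p ^ (v + 1) ∣ D := hfin.not_pow_dvd_of_multiplicity_lt (by omega)
      have hv2 : (p : ℝ) ^ v ≤ D := by
        exact_mod_cast Nat.le_of_dvd hD (pow_multiplicity_dvd p D)
      refine norm_Tqcd_pow_le hs a b (p ^ k) 4 hq0 c d (1024 * D / (p ^ k : ℕ)) _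
        (hgood p hp v hv1 c d (hprim c d hg)) ?_
      intro i hi
      have hS := norm_S_prime_pow_pow_four_le hp k v (Finset.mem_filter.mp hi).2
      rw [hQc, div_pow, div_le_div_iff₀ (by positivity) hQ0]
      calc ‖S (p ^ k) (a i * c + b i * d)‖ ^ 4 * Q
          ≤ (1024 * (p : ℝ) ^ (3 * k + v)) * Q := by gcongr
        _ = 1024 * (p : ℝ) ^ v * Q ^ 4 := by rw [hQ]; ring
        _ ≤ 1024 * D * Q ^ 4 := by gcongr
    rw [hQc]
    refine le_of_pow_le_pow_left₀ four_ne_zero (by positivity) ?_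
    have h1 : (Q * ‖𝔄 s a b (p ^ k)‖) ^ 4 ≤ C * (1 / Q) ^ 3 := by
      calc (Q * ‖𝔄 s a b (p ^ k)‖) ^ 4
          = Q ^ 4 * ‖𝔄 s a b (p ^ k)‖ ^ 4 := by ring
        _ ≤ Q ^ 4 * ((Q ^ 2) ^ 4 * (1024 * D / Q) ^ 15) := by gcongr
        _ = C * (1 / Q) ^ 3 := by
          rw [hC]
          field_simp
    have h2 : (1 / Q) ^ 3 = σ ^ 4 * ((1 / (p : ℝ)) ^ 3) ^ j := by
      have h3 : σ ^ 2 = (1 / (p : ℝ)) ^ 3 := by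
        rw [one_div, inv_pow]
        exact eq_inv_of_mul_eq_one_left hσ2
      rw [show σ ^ 4 = (σ ^ 2) ^ 2 by ring, h3, hQ, hk, ← one_div_pow]
      ring
    have h4 : (1 / (p : ℝ)) ^ 3 ≤ (3 / 5) ^ 4 := by
      calc (1 / (p : ℝ)) ^ 3 ≤ (1 / 2) ^ 3 := by gcongr
        _ ≤ (3 / 5) ^ 4 := by norm_num
    calc (Q * ‖𝔄 s a b (p ^ k)‖) ^ 4 ≤ C * (σ ^ 4 * ((1 / (p : ℝ)) ^ 3) ^ j) := by rwa [← h2]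
      _ ≤ C ^ 4 * (σ ^ 4 * ((3 / 5) ^ 4) ^ j) := by
        gcongr
        exact le_self_pow₀ hC1 (by norm_num)
      _ = (5 / 3 * C * σ * (3 / 5) ^ (j + 1)) ^ 4 := by
        clear_value C
        rw [pow_right_comm, pow_succ]
        ring

/-- The number of solutions of the pair of diagonal quartic equations modulo `q`. -/
def solCount (s : ℕ) (a b : Fin s → ℤ) (q : ℕ) : ℕ :=
  Nat.card {x : Fin s → ZMod q //
    ∑ j, (a j : ZMod q) * x j ^ 4 = 0 ∧ ∑ j, (b j : ZMod q) * x j ^ 4 = 0}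

/-- The normalised density `q^{2-s} M(q)` of solutions modulo `q`. -/
def density (s : ℕ) (a b : Fin s → ℤ) (q : ℕ) : ℝ :=
  (q : ℝ) ^ 2 * solCount s a b q / (q : ℝ) ^ s

lemma solCount_mul (s : ℕ) (a b : Fin s → ℤ) {m n : ℕ} (h : m.Coprime n) :
    solCount s a b (m * n) = solCount s a b m * solCount s a b n := by
  rw [solCount, solCount, solCount, ← Nat.card_prod]
  have φ := ZMod.chineseRemainder h
  have hkey : ∀ (u : Fin s → ℤ) (x : Fin s → ZMod (m * n)),
      ∑ j, (u j : ZMod (m * n)) * x j ^ 4 = 0 ↔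
      ∑ j, (u j : ZMod m) * (φ (x j)).1 ^ 4 = 0 ∧ ∑ j, (u j : ZMod n) * (φ (x j)).2 ^ 4 = 0 := by
    intro u x
    rw [← map_eq_zero_iff φ φ.injective, map_sum, Prod.ext_iff, Prod.fst_sum, Prod.snd_sum]
    simp
  refine Nat.card_congr
    { toFun := fun x => (⟨fun j => (φ (x.1 j)).1, ((hkey a x.1).mp x.2.1).1,
          ((hkey b x.1).mp x.2.2).1⟩,
        ⟨fun j => (φ (x.1 j)).2, ((hkey a x.1).mp x.2.1).2, ((hkey b x.1).mp x.2.2).2⟩)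
      invFun := fun y => ⟨fun j => φ.symm (y.1.1 j, y.2.1 j),
        (hkey a _).mpr (by simpa using ⟨y.1.2.1, y.2.2.1⟩),
        (hkey b _).mpr (by simpa using ⟨y.1.2.2, y.2.2.2⟩)⟩
      left_inv := fun x => by
        ext j
        simp
      right_inv := fun y => by
        ext j <;> simp }

lemma density_mul (s : ℕ) (a b : Fin s → ℤ) {m n : ℕ} (h : m.Coprime n) :
    density s a b (m * n) = density s a b m * density s a b n := by
  rw [density, density, density, solCount_mul s a b h]
  push_cast
  rw [div_mul_div_comm, mul_pow, mul_pow]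
  ring

lemma density_one (s : ℕ) (a b : Fin s → ℤ) : density s a b 1 = 1 := by
  have : solCount s a b 1 = 1 := by
    rw [solCount, Nat.card_eq_one_iff_unique]
    exact ⟨inferInstance, ⟨⟨0, Subsingleton.elim _ _, Subsingleton.elim _ _⟩⟩⟩
  simp [density, this]

lemma addChar_map_sum {ι A M : Type*} [AddCommMonoid A] [CommMonoid M] (ψ : AddChar A M)
    (t : Finset ι) (f : ι → A) : ψ (∑ i ∈ t, f i) = ∏ i ∈ t, ψ (f i) := by
  induction t using Finset.cons_induction with
  | empty => simp
  | cons i t hi ih => rw [Finset.sum_cons, Finset.prod_cons, AddChar.map_add_eq_mul, ih]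

lemma sum_Tqcd_eq_density (s : ℕ) (a b : Fin s → ℤ) (q : ℕ) [NeZero q] :
    ∑ c ∈ Finset.Icc 1 q, ∑ d ∈ Finset.Icc 1 q, Tqcd s a b q (c : ℤ) (d : ℤ)
      = (density s a b q : ℂ) := by
  classical
  set ψ : AddChar (ZMod q) ℂ := ZMod.stdAddChar with hψ
  set A : (Fin s → ZMod q) → ZMod q := fun x => ∑ j, (a j : ZMod q) * x j ^ 4 with hA
  set B : (Fin s → ZMod q) → ZMod q := fun x => ∑ j, (b j : ZMod q) * x j ^ 4 with hB
  have hprod : ∀ c d : ZMod q,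
      ∏ j, ∑ x : ZMod q, ψ (((a j : ZMod q) * c + (b j : ZMod q) * d) * x ^ 4)
        = ∑ x : Fin s → ZMod q, ψ (c * A x) * ψ (d * B x) := by
    intro c d
    rw [Finset.prod_univ_sum, Fintype.piFinset_univ]
    refine Finset.sum_congr rfl fun x _ => ?_
    rw [← AddChar.map_add_eq_mul, ← addChar_map_sum]
    congr 1
    simp only [hA, hB, Finset.mul_sum]
    rw [← Finset.sum_add_distrib]
    exact Finset.sum_congr rfl fun j _ => by ring
  have hcount : ∑ c : ZMod q, ∑ d : ZMod q, ∑ x : Fin s → ZMod q, ψ (c * A x) * ψ (d * B x)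
      = (q : ℂ) ^ 2 * solCount s a b q := by
    calc _ = ∑ x : Fin s → ZMod q, (∑ c : ZMod q, ψ (c * A x)) * ∑ d : ZMod q, ψ (d * B x) := by
          rw [Finset.sum_congr rfl fun c _ => Finset.sum_comm, Finset.sum_comm]
          exact Finset.sum_congr rfl fun x _ => (Finset.sum_mul_sum _ _ _ _).symm
      _ = ∑ x : Fin s → ZMod q, if A x = 0 ∧ B x = 0 then (q : ℂ) ^ 2 else 0 := by
          refine Finset.sum_congr rfl fun x _ => ?_
          rw [AddChar.sum_mulShift _ (ZMod.isPrimitive_stdAddChar q),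
            AddChar.sum_mulShift _ (ZMod.isPrimitive_stdAddChar q), ZMod.card]
          by_cases h1 : A x = 0 <;> by_cases h2 : B x = 0 <;> simp [h1, h2, pow_two]
      _ = _ := by
          rw [← Finset.sum_filter, Finset.sum_const, nsmul_eq_mul, mul_comm, solCount,
            Nat.card_eq_fintype_card, Fintype.card_subtype]
  have hT : ∀ c d : ℕ, Tqcd s a b q (c : ℤ) (d : ℤ) = ((q : ℂ) ^ s)⁻¹ *
      ∏ j, ∑ x : ZMod q, ψ (((a j : ZMod q) * (c : ZMod q) + (b j : ZMod q) * (d : ZMod q))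
        * x ^ 4) := by
    intro c d
    rw [Tqcd]
    congr 1
    refine Finset.prod_congr rfl fun j _ => ?_
    rw [S_eq_sum_zmod]
    push_cast
    rfl
  simp_rw [hT, hprod]
  rw [sum_Icc_cast_zmod q (fun c : ZMod q => ∑ d ∈ Finset.Icc 1 q, ((q : ℂ) ^ s)⁻¹ *
    ∑ x : Fin s → ZMod q, ψ (c * A x) * ψ ((d : ZMod q) * B x))]
  rw [Finset.sum_congr rfl fun c _ => sum_Icc_cast_zmod q (fun d : ZMod q => ((q : ℂ) ^ s)⁻¹ *
    ∑ x : Fin s → ZMod q, ψ (c * A x) * ψ (d * B x))]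
  simp_rw [← Finset.mul_sum]
  rw [hcount, density]
  push_cast
  rw [inv_mul_eq_div]

lemma Tqcd_mul (s : ℕ) (a b : Fin s → ℤ) (g r : ℕ) [NeZero g] [NeZero r] (c d : ℤ) :
    Tqcd s a b (g * r) (g * c) (g * d) = Tqcd s a b r c d := by
  have hg : (g : ℂ) ≠ 0 := Nat.cast_ne_zero.mpr (NeZero.ne g)
  rw [Tqcd, Tqcd]
  have h : ∀ j, S (g * r) (a j * (g * c) + b j * (g * d)) = g * S r (a j * c + b j * d) := by
    intro j
    rw [← S_mul_mul]
    congr 1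
    ring
  simp_rw [h]
  rw [Finset.prod_mul_distrib, Finset.prod_const, Finset.card_univ, Fintype.card_fin]
  push_cast
  rw [mul_pow, mul_inv]
  field_simp

lemma 𝔄_eq_sum_product (s : ℕ) (a b : Fin s → ℤ) (q : ℕ) :
    𝔄 s a b q = ∑ x ∈ (Finset.Icc 1 q ×ˢ Finset.Icc 1 q).filter
      (fun x => Nat.gcd q (Nat.gcd x.1 x.2) = 1), Tqcd s a b q (x.1 : ℤ) (x.2 : ℤ) := by
  rw [𝔄]
  simp_rw [Finset.sum_filter]
  rw [← Finset.sum_product']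

lemma sum_divisors_𝔄 (s : ℕ) (a b : Fin s → ℤ) (q : ℕ) (hq : 0 < q) :
    ∑ r ∈ q.divisors, 𝔄 s a b r = (density s a b q : ℂ) := by
  have : NeZero q := ⟨hq.ne'⟩
  rw [← sum_Tqcd_eq_density, ← Finset.sum_product', ← Nat.sum_div_divisors]
  rw [← Finset.sum_fiberwise_of_maps_to (g := fun x : ℕ × ℕ => Nat.gcd q (Nat.gcd x.1 x.2))
    (t := q.divisors) (fun x _ => Nat.mem_divisors.mpr ⟨Nat.gcd_dvd_left _ _, hq.ne'⟩)]
  refine Finset.sum_congr rfl fun g hg => ?_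
  obtain ⟨r, rfl⟩ := (Nat.mem_divisors.mp hg).1
  have hg0 : 0 < g := Nat.pos_of_mul_pos_right hq
  have hr0 : 0 < r := Nat.pos_of_mul_pos_left hq
  have : NeZero g := ⟨hg0.ne'⟩
  have : NeZero r := ⟨hr0.ne'⟩
  rw [Nat.mul_div_cancel_left r hg0, 𝔄_eq_sum_product]
  refine Finset.sum_nbij (fun x => (g * x.1, g * x.2)) ?_ ?_ ?_ ?_
  · rintro ⟨c, d⟩ hx
    simp only [Finset.mem_filter, Finset.mem_product, Finset.mem_Icc] at hx ⊢
    obtain ⟨⟨⟨hc1, hc2⟩, hd1, hd2⟩, h1⟩ := hx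
    refine ⟨⟨⟨Nat.mul_pos hg0 hc1, Nat.mul_le_mul_left g hc2⟩,
      Nat.mul_pos hg0 hd1, Nat.mul_le_mul_left g hd2⟩, ?_⟩
    rw [Nat.gcd_mul_left, Nat.gcd_mul_left, h1, mul_one]
  · rintro ⟨c, d⟩ _ ⟨c', d'⟩ _ hxy
    simpa [hg0.ne'] using hxy
  · rintro ⟨c, d⟩ hx
    simp only [Finset.coe_filter, Finset.mem_product, Finset.mem_Icc, Set.mem_ofPred_eq] at hx
    obtain ⟨⟨⟨hc1, hc2⟩, hd1, hd2⟩, h1⟩ := hx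
    have hgd : g ∣ Nat.gcd c d := h1 ▸ Nat.gcd_dvd_right (g * r) (Nat.gcd c d)
    obtain ⟨c', rfl⟩ := hgd.trans (Nat.gcd_dvd_left c d)
    obtain ⟨d', rfl⟩ := hgd.trans (Nat.gcd_dvd_right _ d)
    refine ⟨(c', d'), ?_, rfl⟩
    simp only [Finset.coe_filter, Finset.mem_product, Finset.mem_Icc, Set.mem_ofPred_eq]
    rw [Nat.gcd_mul_left, Nat.gcd_mul_left] at h1
    exact ⟨⟨⟨Nat.pos_of_mul_pos_left hc1, Nat.le_of_mul_le_mul_left hc2 hg0⟩,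
      Nat.pos_of_mul_pos_left hd1, Nat.le_of_mul_le_mul_left hd2 hg0⟩,
      Nat.eq_of_mul_eq_mul_left hg0 (by rw [h1, mul_one])⟩
  · rintro ⟨c, d⟩ _
    push_cast
    exact (Tqcd_mul s a b g r c d).symm

lemma exists_arithmeticFunction_𝔄 (s : ℕ) (a b : Fin s → ℤ) :
    ∃ f : ArithmeticFunction ℝ, f.IsMultiplicative ∧ (∀ n, 𝔄 s a b n = (f n : ℂ)) ∧
      ∀ n > 0, ∑ r ∈ n.divisors, f r = density s a b n := by
  set N : ArithmeticFunction ℝ := ⟨fun n => if n = 0 then 0 else density s a b n, by simp⟩ with hN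
  have hNn : ∀ n, n ≠ 0 → N n = density s a b n := fun n hn => by simp [hN, hn]
  have hNmul : N.IsMultiplicative := by
    refine ⟨by rw [hNn 1 one_ne_zero, density_one], fun {m n} h => ?_⟩
    rcases eq_or_ne m 0 with rfl | hm
    · simp
    rcases eq_or_ne n 0 with rfl | hn
    · simp
    rw [hNn _ (mul_ne_zero hm hn), hNn _ hm, hNn _ hn, density_mul s a b h]
  refine ⟨(ArithmeticFunction.moebius : ArithmeticFunction ℝ) * N,
    ArithmeticFunction.isMultiplicative_moebius.intCast.mul hNmul, ?_, ?_⟩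
  · intro n
    rcases Nat.eq_zero_or_pos n with rfl | hn
    · simp [𝔄]
    · have h := (ArithmeticFunction.sum_eq_iff_sum_mul_moebius_eq (f := 𝔄 s a b)
        (g := fun n => (density s a b n : ℂ))).mp (sum_divisors_𝔄 s a b) n hn
      rw [← h, ArithmeticFunction.mul_apply]
      push_cast
      refine Finset.sum_congr rfl fun x hx => ?_
      rw [hNn x.2 (Nat.ne_zero_of_mem_divisorsAntidiagonal hx).2]
      simp
  · refine ArithmeticFunction.sum_eq_iff_sum_mul_moebius_eq.mpr fun n hn => ?_
    rw [ArithmeticFunction.mul_apply]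
    refine Finset.sum_congr rfl fun x hx => ?_
    rw [hNn x.2 (Nat.ne_zero_of_mem_divisorsAntidiagonal hx).2]
    simp

lemma summable_of_multiplicative_of_local_bound {F : ℕ → ℝ} (hF : ∀ n, 0 ≤ F n) (h0 : F 0 = 0)
    (h1 : F 1 = 1) (hmul : ∀ {m n : ℕ}, m.Coprime n → F (m * n) = F m * F n)
    {c : ℕ → ℝ} (hc : Summable c) (hc0 : ∀ n, 0 ≤ c n) {r : ℝ} (hr0 : 0 ≤ r) (hr : r < 1)
    (hloc : ∀ p : ℕ, p.Prime → ∀ j, F (p ^ (j + 1)) ≤ c p * r ^ j) : Summable F := by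
  have hgeo : ∀ p, Summable fun j : ℕ => c p * r ^ j := fun p =>
    (summable_geometric_of_lt_one hr0 hr).mul_left _
  have hs1 : ∀ p : ℕ, p.Prime → Summable fun j => F (p ^ (j + 1)) := fun p hp =>
    Summable.of_nonneg_of_le (fun _ => hF _) (hloc p hp) (hgeo p)
  have hs : ∀ p : ℕ, p.Prime → Summable fun j => F (p ^ j) := fun p hp =>
    (summable_nat_add_iff (f := fun j => F (p ^ j)) 1).mp (hs1 p hp)
  have hle : ∀ p : ℕ, p.Prime → ∑' j, F (p ^ j) ≤ Real.exp (c p * (1 - r)⁻¹) := by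
    intro p hp
    rw [(hs p hp).tsum_eq_zero_add, pow_zero, h1, add_comm]
    refine le_trans ?_ (Real.add_one_le_exp _)
    gcongr
    refine ((hs1 p hp).tsum_le_tsum (hloc p hp) (hgeo p)).trans (le_of_eq ?_)
    rw [tsum_mul_left, tsum_geometric_of_lt_one hr0 hr]
  refine summable_of_sum_le hF (c := Real.exp ((∑' n, c n) * (1 - r)⁻¹)) fun u => ?_
  set N := u.sup id + 1 with hN
  have hsum := (EulerProduct.summable_and_hasSum_smoothNumbers_prod_primesBelow_tsum h1 hmul
    (fun {p} hp => by simpa [abs_of_nonneg (hF _)] using hs p hp) N).2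
  have hind := hasSum_subtype_iff_indicator.mp hsum
  have hu : ∑ n ∈ u, F n = ∑ n ∈ u, (Nat.smoothNumbers N).indicator F n := by
    refine Finset.sum_congr rfl fun n hn => ?_
    rcases eq_or_ne n 0 with rfl | hn0
    · rw [Set.indicator_apply]
      split_ifs <;> simp [h0]
    · rw [Set.indicator_of_mem]
      refine Nat.mem_smoothNumbers.mpr ⟨hn0, fun p hp => ?_⟩
      have h2 : p ≤ n := Nat.le_of_mem_primeFactorsList hp
      have h3 : n ≤ u.sup id := Finset.le_sup (f := id) hn
      omega
  rw [hu]
  refine (sum_le_hasSum u (fun n _ => Set.indicator_nonneg (fun n _ => hF n) n) hind).trans ?_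
  calc ∏ p ∈ N.primesBelow, ∑' j, F (p ^ j)
      ≤ ∏ p ∈ N.primesBelow, Real.exp (c p * (1 - r)⁻¹) :=
        Finset.prod_le_prod (fun p _ => tsum_nonneg fun _ => hF _)
          fun p hp => hle p (Nat.prime_of_mem_primesBelow hp)
    _ = Real.exp ((∑ p ∈ N.primesBelow, c p) * (1 - r)⁻¹) := by
        rw [← Real.exp_sum, Finset.sum_mul]
    _ ≤ _ := by
        have : 0 ≤ (1 - r)⁻¹ := inv_nonneg.mpr (by linarith)
        gcongr
        exact hc.sum_le_tsum _ fun n _ => hc0 n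

lemma tsum_pos_of_multiplicative {f : ℕ → ℝ} (h0 : f 0 = 0)
    (h1 : f 1 = 1) (hmul : ∀ {m n : ℕ}, m.Coprime n → f (m * n) = f m * f n)
    (hf : Summable f) (hpos : ∀ p : ℕ, p.Prime → 0 < ∑' j, f (p ^ j))
    {c : ℕ → ℝ} (hc : Summable c) {r : ℝ} (hr0 : 0 ≤ r) (hr : r < 1)
    (hloc : ∀ p : ℕ, p.Prime → ∀ j, |f (p ^ (j + 1))| ≤ c p * r ^ j) : 0 < ∑' n, f n := by
  have hprod := EulerProduct.eulerProduct_hasProd h1 hmul hf.norm h0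
  have hgeo : ∀ p, HasSum (fun j : ℕ => c p * r ^ j) (c p * (1 - r)⁻¹) := fun p =>
    (hasSum_geometric_of_lt_one hr0 hr).mul_left _
  have hsp : ∀ p : ℕ, p.Prime → Summable fun j => f (p ^ (j + 1)) := fun p hp =>
    Summable.of_norm_bounded (hgeo p).summable (hloc p hp)
  set ε : Nat.Primes → ℝ := fun p => ∑' j, f ((p : ℕ) ^ (j + 1)) with hε
  have hχ : ∀ p : Nat.Primes, ∑' j, f ((p : ℕ) ^ j) = 1 + ε p := by
    intro p
    have hs : Summable fun j => f ((p : ℕ) ^ j) :=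
      (summable_nat_add_iff (f := fun j => f ((p : ℕ) ^ j)) 1).mp (hsp p p.2)
    rw [hs.tsum_eq_zero_add, pow_zero, h1]
  have hεs : Summable ε := by
    refine Summable.of_norm_bounded (g := fun p : Nat.Primes => c p * (1 - r)⁻¹) ?_ fun p => ?_
    · exact (hc.comp_injective Nat.Primes.coe_nat_injective).mul_right _
    · exact tsum_of_norm_bounded (hgeo p) (hloc p p.2)
  have hlog := (Real.summable_log_one_add_of_summable hεs).hasSum
  have hprod2 := Real.hasProd_of_hasSum_log (fun p : Nat.Primes => by
    rw [← hχ]; exact hpos p p.2) hlog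
  simp_rw [hχ] at hprod
  rw [hprod.unique hprod2]
  exact Real.exp_pos _

lemma tendsto_and_tail_of_summable_mul {f : ℕ → ℂ} (h0 : f 0 = 0)
    (hs : Summable fun n : ℕ => (n : ℝ) * ‖f n‖) :
    Summable f ∧ Tendsto (fun X : ℕ => ∑ q ∈ Finset.Icc 1 X, f q) atTop (nhds (∑' n, f n)) ∧
      ∃ C : ℝ, ∀ X : ℕ, 1 ≤ X → ‖(∑' n, f n) - ∑ q ∈ Finset.Icc 1 X, f q‖ ≤ C / (X : ℝ) := by
  have hf : Summable f := by
    refine Summable.of_norm_bounded hs fun n => ?_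
    rcases Nat.eq_zero_or_pos n with rfl | hn
    · simp [h0]
    · exact le_mul_of_one_le_left (norm_nonneg _) (by exact_mod_cast hn)
  have hIcc : ∀ X : ℕ, ∑ q ∈ Finset.Icc 1 X, f q = ∑ q ∈ Finset.range (X + 1), f q := by
    intro X
    rw [Finset.sum_range_succ', h0, add_zero, Finset.range_eq_Ico,
      Finset.sum_Ico_add' f 0 X 1]
    rfl
  refine ⟨hf, ?_, ∑' n : ℕ, (n : ℝ) * ‖f n‖, fun X hX => ?_⟩
  · simp_rw [hIcc]
    exact hf.hasSum.tendsto_sum_nat.comp (tendsto_add_atTop_nat 1)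
  · have hX0 : (0 : ℝ) < X := by exact_mod_cast hX
    rw [hIcc, ← hf.sum_add_tsum_nat_add (X + 1), add_sub_cancel_left]
    have hs' := (summable_nat_add_iff (f := fun n : ℕ => (n : ℝ) * ‖f n‖) (X + 1)).mpr hs
    refine (tsum_of_norm_bounded (hs'.div_const (X : ℝ)).hasSum fun n => ?_).trans ?_
    · rw [le_div_iff₀ hX0, mul_comm]
      refine mul_le_mul_of_nonneg_right ?_ (norm_nonneg _)
      push_cast
      have : (0 : ℝ) ≤ n := Nat.cast_nonneg n
      linarith
    · rw [tsum_div_const]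
      refine div_le_div_of_nonneg_right ?_ hX0.le
      rw [← hs.sum_add_tsum_nat_add (X + 1)]
      exact le_add_of_nonneg_left (Finset.sum_nonneg fun _ _ => by positivity)

lemma exists_pow_four_eq_add {p : ℕ} [Fact p.Prime] {x δ : ℤ_[p]}
    (h : ‖δ‖ < ‖4 * x ^ 3‖ ^ 2) : ∃ y : ℤ_[p], y ^ 4 = x ^ 4 + δ := by
  obtain ⟨c, hc⟩ : ∃ c, c = x ^ 4 + δ := ⟨_, rfl⟩
  have hδ : ‖x ^ 4 - c‖ = ‖δ‖ := by rw [hc, sub_add_cancel_left, norm_neg]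
  have hder : (Polynomial.X ^ 4 - Polynomial.C c : Polynomial ℤ_[p]).derivative.aeval x =
      4 * x ^ 3 := by
    rw [Polynomial.derivative_sub, Polynomial.derivative_C, Polynomial.derivative_X_pow]
    simp
  obtain ⟨z, hz, -⟩ := hensels_lemma
    (F := (Polynomial.X ^ 4 - Polynomial.C c : Polynomial ℤ_[p])) (a := x) (by
      rw [hder]
      simpa [hδ] using h)
  exact ⟨z, by simpa [sub_eq_zero, hc] using hz⟩

lemma exists_pow_eq_mul_norm_lt {p : ℕ} [Fact p.Prime] {Δ : ℤ_[p]} (hΔ : Δ ≠ 0) {ε : ℝ}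
    (hε : 0 < ε) : ∃ (t : ℕ) (w : ℤ_[p]), (p : ℤ_[p]) ^ t = Δ * w ∧ ‖w‖ < ε := by
  have hp1 : ‖(p : ℤ_[p])‖ < 1 := by
    rw [PadicInt.norm_p]
    exact inv_lt_one_of_one_lt₀ (by exact_mod_cast (Fact.out : p.Prime).one_lt)
  obtain ⟨m, hm⟩ := exists_pow_lt_of_lt_one hε hp1
  set u := PadicInt.unitCoeff hΔ
  refine ⟨Δ.valuation + m, (↑u⁻¹ : ℤ_[p]) * (p : ℤ_[p]) ^ m, ?_, ?_⟩
  · have hu : (u : ℤ_[p]) * (↑u⁻¹ : ℤ_[p]) = 1 := u.mul_inv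
    rw [pow_add]
    nth_rewrite 2 [PadicInt.unitCoeff_spec hΔ]
    linear_combination (-(p : ℤ_[p]) ^ Δ.valuation * (p : ℤ_[p]) ^ m) * hu
  · rw [norm_mul, PadicInt.norm_units, one_mul, norm_pow]
    exact hm

lemma exists_integral_solution {s p : ℕ} [Fact p.Prime] {a b : Fin s → ℤ} {x : Fin s → ℚ_[p]}
    (ha : ∑ j, (a j : ℚ_[p]) * x j ^ 4 = 0) (hb : ∑ j, (b j : ℚ_[p]) * x j ^ 4 = 0)
    {i j : Fin s} (hij : (a i : ℚ_[p]) * x i ^ 3 * ((b j : ℚ_[p]) * x j ^ 3)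
      - (a j : ℚ_[p]) * x j ^ 3 * ((b i : ℚ_[p]) * x i ^ 3) ≠ 0) :
    ∃ y : Fin s → ℤ_[p], ∑ j, (a j : ℤ_[p]) * y j ^ 4 = 0 ∧ ∑ j, (b j : ℤ_[p]) * y j ^ 4 = 0 ∧
      i ≠ j ∧ (a i : ℤ_[p]) * b j - a j * b i ≠ 0 ∧ y i ≠ 0 ∧ y j ≠ 0 := by
  obtain ⟨c, hc⟩ := IsLocalization.exist_integer_multiples_of_finite
    (nonZeroDivisors ℤ_[p]) x
  choose y hy using hc
  have hinj : Function.Injective (algebraMap ℤ_[p] ℚ_[p]) := IsFractionRing.injective _ _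
  have hc0 : algebraMap ℤ_[p] ℚ_[p] c ≠ 0 :=
    (map_ne_zero_iff _ hinj).mpr (nonZeroDivisors.ne_zero c.2)
  have hy' : ∀ l, algebraMap ℤ_[p] ℚ_[p] (y l) = algebraMap ℤ_[p] ℚ_[p] c * x l := fun l => by
    rw [hy, Algebra.smul_def]
  have heq : ∀ f : Fin s → ℤ, ∑ j, (f j : ℚ_[p]) * x j ^ 4 = 0 →
      ∑ j, (f j : ℤ_[p]) * y j ^ 4 = 0 := by
    intro f hf
    apply hinj
    simp only [map_sum, map_mul, map_pow, map_intCast, map_zero, hy']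
    calc _ = algebraMap ℤ_[p] ℚ_[p] c ^ 4 * ∑ j, (f j : ℚ_[p]) * x j ^ 4 := by
          rw [Finset.mul_sum]
          exact Finset.sum_congr rfl fun _ _ => by ring
      _ = 0 := by rw [hf, mul_zero]
  have hfac : ((a i : ℚ_[p]) * b j - a j * b i) * x i ^ 3 * x j ^ 3 ≠ 0 := by
    convert hij using 1
    ring
  have hne : ∀ l, x l ^ 3 ≠ 0 → y l ≠ 0 := by
    intro l hl h0
    have := hy' l
    rw [h0, map_zero, eq_comm, mul_eq_zero, or_iff_right hc0] at this
    simp [this] at hl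
  refine ⟨y, heq a ha, heq b hb, ?_, ?_, hne _ (right_ne_zero_of_mul (left_ne_zero_of_mul hfac)),
    hne _ (right_ne_zero_of_mul hfac)⟩
  · rintro rfl
    simp at hij
  · have h1 := left_ne_zero_of_mul (left_ne_zero_of_mul hfac)
    intro h0
    apply h1
    have := congrArg (algebraMap ℤ_[p] ℚ_[p]) h0
    simpa using this

lemma sum_update_update {ι R : Type*} [Fintype ι] [DecidableEq ι] [CommRing R] {i j : ι}
    (hij : i ≠ j) (f z : ι → R) (u v : R) :
    ∑ l, f l * Function.update (Function.update z i u) j v l ^ 4 =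
      ∑ l, f l * z l ^ 4 + f i * (u ^ 4 - z i ^ 4) + f j * (v ^ 4 - z j ^ 4) := by
  have hsplit : ∀ g : ι → R, ∑ l, g l = g i + (g j + ∑ l ∈ (Finset.univ.erase i).erase j, g l) := by
    intro g
    rw [Finset.add_sum_erase _ g (by simp [hij.symm]), Finset.add_sum_erase _ g (by simp)]
  rw [hsplit, hsplit (fun l => f l * z l ^ 4)]
  have hrest : ∑ l ∈ (Finset.univ.erase i).erase j,
      f l * Function.update (Function.update z i u) j v l ^ 4 =
      ∑ l ∈ (Finset.univ.erase i).erase j, f l * z l ^ 4 := by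
    refine Finset.sum_congr rfl fun l hl => ?_
    simp only [Finset.mem_erase, Finset.mem_univ, and_true] at hl
    rw [Function.update_of_ne hl.1, Function.update_of_ne hl.2]
  rw [hrest, Function.update_self, Function.update_of_ne hij, Function.update_self]
  ring

lemma exists_solution_of_congr {s p : ℕ} [Fact p.Prime] {a b : Fin s → ℤ} {x : Fin s → ℤ_[p]}
    (ha : ∑ j, (a j : ℤ_[p]) * x j ^ 4 = 0) (hb : ∑ j, (b j : ℤ_[p]) * x j ^ 4 = 0)
    {i j : Fin s} (hij : i ≠ j) {t : ℕ} {w : ℤ_[p]}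
    (ht : (p : ℤ_[p]) ^ t = ((a i : ℤ_[p]) * b j - a j * b i) * w)
    (hwi : ‖w‖ < ‖4 * x i ^ 3‖ ^ 2) (hwj : ‖w‖ < ‖4 * x j ^ 3‖ ^ 2) (n : Fin s → ℤ_[p])
    (hni : n i = 0) (hnj : n j = 0) :
    ∃ y : Fin s → ℤ_[p], ∑ j, (a j : ℤ_[p]) * y j ^ 4 = 0 ∧ ∑ j, (b j : ℤ_[p]) * y j ^ 4 = 0 ∧
      ∀ l, l ≠ i → l ≠ j → y l = x l + p ^ t * n l := by
  set z : Fin s → ℤ_[p] := fun l => x l + p ^ t * n l with hz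
  have hg : ∀ l, ∃ g, z l ^ 4 = x l ^ 4 + p ^ t * g := by
    intro l
    obtain ⟨g, hg⟩ := sub_dvd_pow_sub_pow (z l) (x l) 4
    refine ⟨n l * g, ?_⟩
    simp only [hz, add_sub_cancel_left] at hg ⊢
    linear_combination hg
  choose g hg using hg
  have hsum : ∀ f : Fin s → ℤ, ∑ j, (f j : ℤ_[p]) * x j ^ 4 = 0 →
      ∑ l, (f l : ℤ_[p]) * z l ^ 4 = p ^ t * ∑ l, (f l : ℤ_[p]) * g l := by
    intro f hf
    calc _ = ∑ j, (f j : ℤ_[p]) * x j ^ 4 + ∑ l, p ^ t * ((f l : ℤ_[p]) * g l) := by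
          rw [← Finset.sum_add_distrib]
          exact Finset.sum_congr rfl fun l _ => by rw [hg]; ring
      _ = _ := by rw [hf, zero_add, Finset.mul_sum]
  set e₁ := ∑ l, (a l : ℤ_[p]) * g l
  set e₂ := ∑ l, (b l : ℤ_[p]) * g l
  have hsmall : ∀ c : ℤ_[p], ‖w * c‖ ≤ ‖w‖ := fun c => by
    rw [norm_mul]
    exact mul_le_of_le_one_right (norm_nonneg _) (PadicInt.norm_le_one c)
  obtain ⟨u, hu⟩ := exists_pow_four_eq_add (x := x i) (δ := w * (e₂ * a j - e₁ * b j))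
    ((hsmall _).trans_lt hwi)
  obtain ⟨v, hv⟩ := exists_pow_four_eq_add (x := x j) (δ := w * (e₁ * b i - e₂ * a i))
    ((hsmall _).trans_lt hwj)
  have hzi : z i = x i := by simp [hz, hni]
  have hzj : z j = x j := by simp [hz, hnj]
  refine ⟨Function.update (Function.update z i u) j v, ?_, ?_, fun l hli hlj => ?_⟩
  · rw [sum_update_update hij, hsum a ha, hzi, hzj, hu, hv, ht]
    ring
  · rw [sum_update_update hij, hsum b hb, hzi, hzj, hu, hv, ht]
    ring
  · rw [Function.update_of_ne hlj, Function.update_of_ne hli]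

lemma pow_le_solCount {s p : ℕ} [Fact p.Prime] {a b : Fin s → ℤ} {x : Fin s → ℤ_[p]}
    (ha : ∑ j, (a j : ℤ_[p]) * x j ^ 4 = 0) (hb : ∑ j, (b j : ℤ_[p]) * x j ^ 4 = 0)
    {i j : Fin s} (hij : i ≠ j) {t : ℕ} {w : ℤ_[p]}
    (ht : (p : ℤ_[p]) ^ t = ((a i : ℤ_[p]) * b j - a j * b i) * w)
    (hwi : ‖w‖ < ‖4 * x i ^ 3‖ ^ 2) (hwj : ‖w‖ < ‖4 * x j ^ 3‖ ^ 2) {k : ℕ} (hk : t ≤ k) :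
    (p ^ (k - t)) ^ (s - 2) ≤ solCount s a b (p ^ k) := by
  have hp0 : p ≠ 0 := (Fact.out : p.Prime).ne_zero
  have : NeZero (p ^ k) := ⟨pow_ne_zero _ hp0⟩
  let I := {l : Fin s // ¬(l = i ∨ l = j)}
  have hcard : Nat.card (I → Fin (p ^ (k - t))) = (p ^ (k - t)) ^ (s - 2) := by
    have hI : Fintype.card I = s - 2 := by
      rw [Fintype.card_subtype_compl, Fintype.card_fin, Fintype.card_subtype]
      congr 1
      rw [← Finset.card_pair hij]
      congr 1
      ext l
      simp
    rw [Nat.card_eq_fintype_card, Fintype.card_fun, Fintype.card_fin, hI]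
  have hlift : ∀ n : I → Fin (p ^ (k - t)), ∃ y : Fin s → ℤ_[p],
      ∑ j, (a j : ℤ_[p]) * y j ^ 4 = 0 ∧ ∑ j, (b j : ℤ_[p]) * y j ^ 4 = 0 ∧
        ∀ l : I, y l = x l + p ^ t * ((n l : ℕ) : ℤ_[p]) := by
    intro n
    obtain ⟨y, h1, h2, h3⟩ := exists_solution_of_congr ha hb hij ht hwi hwj
      (fun l => if h : ¬(l = i ∨ l = j) then ((n ⟨l, h⟩ : ℕ) : ℤ_[p]) else 0)
      (by simp) (by simp)
    refine ⟨y, h1, h2, fun l => ?_⟩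
    have hl := l.2
    rw [h3 l (fun h => hl (Or.inl h)) (fun h => hl (Or.inr h)), dif_pos hl]
  choose Y hY1 hY2 hY3 using hlift
  rw [← hcard, solCount]
  refine Nat.card_le_card_of_injective
    (fun n => ⟨fun l => PadicInt.toZModPow k (Y n l), ?_, ?_⟩) ?_
  · simpa using congrArg (PadicInt.toZModPow k) (hY1 n)
  · simpa using congrArg (PadicInt.toZModPow k) (hY2 n)
  · intro n m hnm
    funext l
    have h1 : PadicInt.toZModPow k (Y n l) = PadicInt.toZModPow k (Y m l) :=
      congrFun (congrArg Subtype.val hnm) (l : Fin s)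
    rw [hY3, hY3] at h1
    have h2 : ((p ^ t * (n l : ℕ) : ℕ) : ZMod (p ^ k)) = ((p ^ t * (m l : ℕ) : ℕ) : ZMod (p ^ k)) := by
      simpa using h1
    rw [ZMod.natCast_eq_natCast_iff] at h2
    have hlt : ∀ q : Fin (p ^ (k - t)), p ^ t * (q : ℕ) < p ^ k := by
      intro q
      calc p ^ t * (q : ℕ) < p ^ t * p ^ (k - t) :=
            Nat.mul_lt_mul_of_pos_left q.2 (pow_pos (Nat.pos_of_ne_zero hp0) _)
        _ = p ^ k := by rw [← pow_add, Nat.add_sub_cancel' hk]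
    have h3 := h2.eq_of_lt_of_lt (hlt _) (hlt _)
    exact Fin.ext (Nat.eq_of_mul_eq_mul_left (pow_pos (Nat.pos_of_ne_zero hp0) _) h3)

lemma exists_pos_le_density {s : ℕ} (hs : 2 ≤ s) {p : ℕ} [Fact p.Prime] {a b : Fin s → ℤ}
    {x : Fin s → ℚ_[p]}
    (ha : ∑ j, (a j : ℚ_[p]) * x j ^ 4 = 0) (hb : ∑ j, (b j : ℚ_[p]) * x j ^ 4 = 0)
    {i j : Fin s} (hij : (a i : ℚ_[p]) * x i ^ 3 * ((b j : ℚ_[p]) * x j ^ 3)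
      - (a j : ℚ_[p]) * x j ^ 3 * ((b i : ℚ_[p]) * x i ^ 3) ≠ 0) :
    ∃ c : ℝ, 0 < c ∧ ∃ t : ℕ, ∀ k, t ≤ k → c ≤ density s a b (p ^ k) := by
  obtain ⟨y, hya, hyb, hne, hΔ, hyi, hyj⟩ := exists_integral_solution ha hb hij
  have hpos : ∀ z : ℤ_[p], z ≠ 0 → 0 < ‖4 * z ^ 3‖ ^ 2 := fun z hz => by
    have : (4 : ℤ_[p]) ≠ 0 := by norm_num
    have := norm_pos_iff.mpr (mul_ne_zero this (pow_ne_zero 3 hz))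
    positivity
  obtain ⟨t, w, ht, hw⟩ := exists_pow_eq_mul_norm_lt hΔ (lt_min (hpos _ hyi) (hpos _ hyj))
  have hp0 : (0 : ℝ) < p := by exact_mod_cast (Fact.out : p.Prime).pos
  refine ⟨(((p : ℝ) ^ t) ^ (s - 2))⁻¹, by positivity, t, fun k hk => ?_⟩
  have hcount : (((p : ℝ) ^ (k - t)) ^ (s - 2)) ≤ solCount s a b (p ^ k) := by
    exact_mod_cast pow_le_solCount hya hyb hne ht (hw.trans_le (min_le_left _ _))
      (hw.trans_le (min_le_right _ _)) hk
  rw [density, Nat.cast_pow, le_div_iff₀ (by positivity)]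
  refine le_trans (le_of_eq ?_) (mul_le_mul_of_nonneg_left hcount (by positivity))
  obtain ⟨m, rfl⟩ := Nat.exists_eq_add_of_le hk
  obtain ⟨r, rfl⟩ := Nat.exists_eq_add_of_le hs
  rw [Nat.add_sub_cancel_left, Nat.add_sub_cancel_left, inv_mul_eq_div, div_eq_iff (by positivity)]
  rw [pow_add (p : ℝ) t m, pow_add _ 2 r, mul_pow _ _ r]
  ring

lemma summable_const_mul_natCast_rpow (K : ℝ) :
    Summable fun n : ℕ => K * (n : ℝ) ^ (-(3 / 2) : ℝ) :=
  (Real.summable_nat_rpow.mpr (by norm_num)).mul_left K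

lemma tsum_prime_pow_pos {s : ℕ} {a b : Fin s → ℤ} {f : ℕ → ℝ}
    (hf : ∀ n > 0, ∑ r ∈ n.divisors, f r = density s a b n) {p : ℕ} (hp : p.Prime)
    (hs : Summable fun j => f (p ^ j)) {c : ℝ} (hc : 0 < c) {t : ℕ}
    (ht : ∀ k, t ≤ k → c ≤ density s a b (p ^ k)) : 0 < ∑' j, f (p ^ j) := by
  have hlim := hs.hasSum.tendsto_sum_nat.comp (tendsto_add_atTop_nat 1)
  refine hc.trans_le (ge_of_tendsto hlim ?_)
  filter_upwards [eventually_ge_atTop t] with k hk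
  have := ht k hk
  rw [← hf _ (pow_pos hp.pos k), Nat.sum_divisors_prime_pow hp] at this
  exact this

/-- the singular series `𝔖 = lim_X 𝔖(X)` converges, with
`|𝔖 − 𝔖(X)| ≪ X⁻¹`; and if the system has non-singular `p`-adic solutions for every
prime `p`, then `𝔖 > 0`. -/
theorem singular_series_convergence_positivity (s : ℕ) (hs : 22 ≤ s) (a b : Fin s → ℤ)
    (hcond : ∀ c d : ℤ, ¬(c = 0 ∧ d = 0) →
      s - 7 ≤ (Finset.univ.filter (fun j : Fin s => c * a j + d * b j ≠ 0)).card) :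
    ∃ 𝔖 : ℂ,
      Filter.Tendsto (fun X : ℕ => 𝔖X s a b X) Filter.atTop (nhds 𝔖) ∧
      (∃ C : ℝ, ∀ X : ℕ, 1 ≤ X → ‖𝔖 - 𝔖X s a b X‖ ≤ C / (X : ℝ)) ∧
      ((∀ p : ℕ, ∀ _ : Fact p.Prime, ∃ x : Fin s → ℚ_[p],
          (∑ j, (a j : ℚ_[p]) * x j ^ 4 = 0) ∧ (∑ j, (b j : ℚ_[p]) * x j ^ 4 = 0) ∧
          ∃ i j : Fin s,
            (a i : ℚ_[p]) * x i ^ 3 * ((b j : ℚ_[p]) * x j ^ 3)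
              - (a j : ℚ_[p]) * x j ^ 3 * ((b i : ℚ_[p]) * x i ^ 3) ≠ 0) →
        0 < 𝔖.re) := by
  obtain ⟨K, hK0, hK⟩ := local_bound s hs a b hcond
  obtain ⟨f, hfmul, hf𝔄, hfdiv⟩ := exists_arithmeticFunction_𝔄 s a b
  have hnorm : ∀ n, ‖𝔄 s a b n‖ = |f n| := fun n => by
    rw [hf𝔄, Complex.norm_real, Real.norm_eq_abs]
  set c : ℕ → ℝ := fun n => K * (n : ℝ) ^ (-(3 / 2) : ℝ) with hc
  have hcs : Summable c := summable_const_mul_natCast_rpow K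
  have hc0 : ∀ n, 0 ≤ c n := fun n => by positivity
  have hloc : ∀ p : ℕ, p.Prime → ∀ j,
      ((p ^ (j + 1) : ℕ) : ℝ) * |f (p ^ (j + 1))| ≤ c p * (3 / 5) ^ j := fun p hp j => by
    rw [← hnorm]
    exact hK p hp j
  have hsum : Summable fun n : ℕ => (n : ℝ) * |f n| := by
    refine summable_of_multiplicative_of_local_bound (F := fun n : ℕ => (n : ℝ) * |f n|)
      (fun n => by positivity) (by simp) (by simp [hfmul.map_one]) (fun {m n} hmn => ?_)
      hcs hc0 (by norm_num : (0 : ℝ) ≤ 3 / 5) (by norm_num) hloc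
    rw [hfmul.map_mul_of_coprime hmn, abs_mul]
    push_cast
    ring
  obtain ⟨hsummable, hlim, htail⟩ := tendsto_and_tail_of_summable_mul (f := 𝔄 s a b)
    (by simp [𝔄]) (by simpa only [hnorm] using hsum)
  refine ⟨∑' n, 𝔄 s a b n, hlim, htail, fun hsol => ?_⟩
  simp only [hf𝔄]
  rw [← Complex.ofReal_tsum, Complex.ofReal_re]
  have hfs : Summable f := Complex.summable_ofReal.mp (hsummable.congr hf𝔄)
  have hloc' : ∀ p : ℕ, p.Prime → ∀ j, |f (p ^ (j + 1))| ≤ c p * (3 / 5) ^ j :=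
    fun p hp j => (le_mul_of_one_le_left (abs_nonneg _)
      (by exact_mod_cast Nat.one_le_pow _ _ hp.pos)).trans (hloc p hp j)
  refine tsum_pos_of_multiplicative (by simp) hfmul.map_one
    (fun hmn => hfmul.map_mul_of_coprime hmn) hfs (fun p hp => ?_) hcs
    (by norm_num : (0 : ℝ) ≤ 3 / 5) (by norm_num) hloc'
  have : Fact p.Prime := ⟨hp⟩
  obtain ⟨x, hxa, hxb, i, j, hij⟩ := hsol p this
  obtain ⟨δ, hδ, t, ht⟩ := exists_pos_le_density (by omega) hxa hxb hij
  exact tsum_prime_pow_pos hfdiv hp (hfs.comp_injective (Nat.pow_right_injective hp.two_le)) hδ ht
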